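/- Define the sequence λ by λ_{IJ} := |I|^{1/2}|J|^{1/2} if |I| = |J| and I × J ⊆ [0,1)², and λ_{IJ} := 0 otherwise. Then λ is non-negative, ‖λ‖_{X'} = ‖λ‖_X = 1, and ‖λ‖_{BMO_rect} = ∞. In particular, P_λ is unconditionally bounded on L²(ℝ²) although λ fails to lie in rectangular BMO. -/

import Mathlib

open MeasureTheory
open scoped ENNReal

noncomputable section

/-- A sequence `λ = (λ_{IJ})` indexed by pairs of dyadic intervals; a dyadic interval
`[2^{-i}k, 2^{-i}(k+1))` is encoded by the pair `(i, k) : ℤ × ℤ`. -/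
abbrev ParaSeq := (ℤ × ℤ) → (ℤ × ℤ) → ℝ

/-- The dyadic interval `[2^{-i} k, 2^{-i}(k+1))` encoded by the pair `p = (i, k) : ℤ × ℤ`. -/
def dyadic (p : ℤ × ℤ) : Set ℝ := Set.Ico ((2:ℝ) ^ (-p.1) * p.2) ((2:ℝ) ^ (-p.1) * (p.2 + 1))

/-- The length `|I| = 2^{-i}` of the dyadic interval encoded by `p = (i, k)`. -/
def dlen (p : ℤ × ℤ) : ℝ := (2:ℝ) ^ (-p.1)

/-- The average `⟨f⟩_I = |I|⁻¹ ∫_I f`. -/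
def avg (f : ℝ → ℝ) (p : ℤ × ℤ) : ℝ := (dlen p)⁻¹ * ∫ x in dyadic p, f x

/-- Admissible families `(u_I)_{I ∈ D}` of `L²(ℝ)` functions: only finitely many nonzero
members and `Σ_I ‖u_I‖₂² = 1`. -/
def Adm : Set ((ℤ × ℤ) → ℝ → ℝ) :=
  {u | (∀ p, MemLp (u p) 2 volume) ∧ {p | u p ≠ 0}.Finite ∧ (∑' p : ℤ × ℤ, ∫ x, (u p x) ^ 2) = 1}

/-- The bilinear sum `Σ_{I,J} λ_{IJ} ⟨g_J⟩_I ⟨u_I⟩_J`. -/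
def pairSum (lam : ParaSeq) (u g : (ℤ × ℤ) → ℝ → ℝ) : ℝ :=
  ∑' pq : (ℤ × ℤ) × (ℤ × ℤ), lam pq.1 pq.2 * avg (g pq.2) pq.1 * avg (u pq.1) pq.2

/-- The norm `‖λ‖_X`, as an element of `[0, ∞]`. -/
def Xnorm (lam : ParaSeq) : ℝ≥0∞ :=
  ⨆ (u : Adm) (g : Adm), ENNReal.ofReal |pairSum lam u.1 g.1|

/-- The norm `‖λ‖_{X'}`, as an element of `[0, ∞]`. -/
def Xprime (lam : ParaSeq) : ℝ≥0∞ :=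
  ⨆ (u : Adm) (g : Adm),
    ENNReal.ofReal
      (∑' pq : (ℤ × ℤ) × (ℤ × ℤ), |lam pq.1 pq.2 * avg (g.1 pq.2) pq.1 * avg (u.1 pq.1) pq.2|)

/-- The rectangular BMO norm `‖λ‖_{BMO_rect}`, as an element of `[0, ∞]`. -/
def rectBMO (lam : ParaSeq) : ℝ≥0∞ :=
  ⨆ (p : ℤ × ℤ) (q : ℤ × ℤ),
    ((ENNReal.ofReal (dlen p * dlen q))⁻¹ *
      ∑' r : {r : (ℤ × ℤ) × (ℤ × ℤ) // dyadic r.1 ⊆ dyadic p ∧ dyadic r.2 ⊆ dyadic q},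
        ENNReal.ofReal ((lam r.1.1 r.1.2) ^ 2)) ^ (1/2 : ℝ)

open Classical in
/-- The sequence `λ_{IJ} = |I|^{1/2}|J|^{1/2}` if `|I| = |J|` and `I × J ⊆ [0,1)²`, else `0`. -/
def lamDiag : ParaSeq := fun p q =>
  if p.1 = q.1 ∧ dyadic p ⊆ Set.Ico (0:ℝ) 1 ∧ dyadic q ⊆ Set.Ico (0:ℝ) 1 then
    Real.sqrt (dlen p) * Real.sqrt (dlen q)
  else 0

lemma dlen_pos (p : ℤ × ℤ) : 0 < dlen p := zpow_pos two_pos _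

lemma measurableSet_dyadic (p : ℤ × ℤ) : MeasurableSet (dyadic p) := measurableSet_Ico

lemma dyadic_zero : dyadic (0, 0) = Set.Ico (0 : ℝ) 1 := by simp [dyadic]

lemma volume_real_dyadic (p : ℤ × ℤ) : volume.real (dyadic p) = dlen p := by
  have h := dlen_pos p
  unfold dlen at h
  rw [dyadic, Real.volume_real_Ico_of_le (by nlinarith), dlen]
  ring

/-- Dyadic intervals of the same length are pairwise disjoint. -/
lemma disjoint_dyadic {p q : ℤ × ℤ} (h : p.1 = q.1) (hpq : p ≠ q) :
    Disjoint (dyadic p) (dyadic q) := by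
  rw [Set.disjoint_left]
  rintro x ⟨h1, h2⟩ ⟨h3, h4⟩
  rw [h] at h1 h2
  have hpos : (0 : ℝ) < 2 ^ (-q.1) := zpow_pos two_pos _
  have h5 : (p.2 : ℝ) < q.2 + 1 := lt_of_mul_lt_mul_left (h1.trans_lt h4) hpos.le
  have h6 : (q.2 : ℝ) < p.2 + 1 := lt_of_mul_lt_mul_left (h3.trans_lt h2) hpos.le
  norm_cast at h5 h6
  exact hpq (Prod.ext h (by omega))

/-- The Cauchy–Schwarz inequality for averages: `|I| ⟨f⟩_I² ≤ ∫_I f²`. -/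
lemma dlen_mul_avg_sq_le {f : ℝ → ℝ} (hf : MemLp f 2 volume) (p : ℤ × ℤ) :
    dlen p * avg f p ^ 2 ≤ ∫ x in dyadic p, f x ^ 2 := by
  have hfin : IsFiniteMeasure (volume.restrict (dyadic p)) :=
    ⟨by simp [dyadic]⟩
  have hf' : MemLp f 2 (volume.restrict (dyadic p)) := hf.restrict _
  have hi : Integrable f (volume.restrict (dyadic p)) := hf'.integrable (by norm_num)
  have hi2 : Integrable (fun x => f x ^ 2) (volume.restrict (dyadic p)) := hf'.integrable_sq
  set a := avg f p with ha
  have hint : ∫ x in dyadic p, f x = dlen p * a := by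
    rw [ha, avg, mul_inv_cancel_left₀ (dlen_pos p).ne']
  have hnonneg : 0 ≤ ∫ x in dyadic p, (f x ^ 2 - 2 * a * f x + a ^ 2) :=
    integral_nonneg fun x => by
      have := sq_nonneg (f x - a)
      simp only [Pi.zero_apply]
      linarith
  rw [integral_add (f := fun x => f x ^ 2 - 2 * a * f x) (hi2.sub (hi.const_mul _))
      (integrable_const _), integral_sub hi2 (hi.const_mul _), integral_const_mul, hint, setIntegral_const,
    volume_real_dyadic, smul_eq_mul] at hnonneg
  linarith

/-- For an admissible family, the local squared norms over equal-length pairs sum to at most 1. -/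
lemma sum_setIntegral_sq_le_one {u : (ℤ × ℤ) → ℝ → ℝ} (hu : u ∈ Adm)
    (s : Finset ((ℤ × ℤ) × (ℤ × ℤ))) :
    ∑ pq ∈ s, (if pq.1.1 = pq.2.1 then ∫ x in dyadic pq.2, u pq.1 x ^ 2 else 0) ≤ 1 := by
  obtain ⟨hL, hfin, hsum⟩ := hu
  have hnonneg : ∀ pq : (ℤ × ℤ) × (ℤ × ℤ),
      0 ≤ if pq.1.1 = pq.2.1 then ∫ x in dyadic pq.2, u pq.1 x ^ 2 else 0 := by
    intro pq
    split_ifs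
    · exact integral_nonneg fun x => sq_nonneg _
    · exact le_rfl
  have hsummable : Summable fun p : ℤ × ℤ => ∫ x, u p x ^ 2 := by
    refine summable_of_hasFiniteSupport (hfin.subset fun p hp hzero => hp ?_)
    simp [hzero]
  calc _ ≤ ∑ pq ∈ s.image Prod.fst ×ˢ s.image Prod.snd,
        (if pq.1.1 = pq.2.1 then ∫ x in dyadic pq.2, u pq.1 x ^ 2 else 0) :=
        Finset.sum_le_sum_of_subset_of_nonneg Finset.subset_product fun pq _ _ => hnonneg pq
    _ = ∑ p ∈ s.image Prod.fst, ∑ q ∈ s.image Prod.snd,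
        (if p.1 = q.1 then ∫ x in dyadic q, u p x ^ 2 else 0) := Finset.sum_product _ _ _
    _ ≤ ∑ p ∈ s.image Prod.fst, ∫ x, u p x ^ 2 := by
        refine Finset.sum_le_sum fun p _ => ?_
        rw [← Finset.sum_filter, ← integral_biUnion_finset _ (fun q _ => measurableSet_dyadic q)]
        · exact setIntegral_le_integral (hL p).integrable_sq
            (Filter.Eventually.of_forall fun x => sq_nonneg _)
        · intro q hq r hr hqr
          simp only [Finset.coe_filter, Set.mem_ofPred_eq] at hq hr
          exact disjoint_dyadic (hq.2.symm.trans hr.2) hqr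
        · exact fun q _ => (hL p).integrable_sq.integrableOn
    _ ≤ ∑' p : ℤ × ℤ, ∫ x, u p x ^ 2 :=
        hsummable.sum_le_tsum _ fun p _ => integral_nonneg fun x => sq_nonneg _
    _ = 1 := hsum

lemma lamDiag_nonneg (p q : ℤ × ℤ) : 0 ≤ lamDiag p q := by
  unfold lamDiag
  split_ifs <;> positivity

lemma lamDiag_of_level_eq {p q : ℤ × ℤ} (h : p.1 = q.1) (hp : dyadic p ⊆ Set.Ico (0 : ℝ) 1)
    (hq : dyadic q ⊆ Set.Ico (0 : ℝ) 1) : lamDiag p q = dlen p := by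
  have : dlen q = dlen p := by rw [dlen, dlen, h]
  rw [lamDiag, if_pos ⟨h, hp, hq⟩, this, Real.mul_self_sqrt (dlen_pos p).le]

lemma abs_lamDiag_term_le {f g : ℝ → ℝ} (hf : MemLp f 2 volume) (hg : MemLp g 2 volume)
    (p q : ℤ × ℤ) :
    |lamDiag p q * avg g p * avg f q| ≤
      ((if p.1 = q.1 then ∫ x in dyadic q, f x ^ 2 else 0) +
        (if q.1 = p.1 then ∫ x in dyadic p, g x ^ 2 else 0)) / 2 := by
  by_cases h : p.1 = q.1
  · rw [if_pos h, if_pos h.symm]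
    have hq := dlen_mul_avg_sq_le hf q
    have hp := dlen_mul_avg_sq_le hg p
    have hle : lamDiag p q ≤ dlen p := by
      by_cases hc : dyadic p ⊆ Set.Ico (0 : ℝ) 1 ∧ dyadic q ⊆ Set.Ico (0 : ℝ) 1
      · exact (lamDiag_of_level_eq h hc.1 hc.2).le
      · rw [lamDiag, if_neg fun hc' => hc hc'.2]
        exact (dlen_pos p).le
    have heq : dlen q = dlen p := by rw [dlen, dlen, h]
    rw [heq] at hq
    have habs : |avg g p| * |avg f q| ≤ (avg g p ^ 2 + avg f q ^ 2) / 2 := by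
      nlinarith [sq_nonneg (|avg g p| - |avg f q|), sq_abs (avg g p), sq_abs (avg f q)]
    rw [mul_assoc, abs_mul, abs_mul, abs_of_nonneg (lamDiag_nonneg p q)]
    calc _ ≤ dlen p * ((avg g p ^ 2 + avg f q ^ 2) / 2) :=
          mul_le_mul hle habs (by positivity) (dlen_pos p).le
      _ ≤ _ := by linarith
  · rw [if_neg h, if_neg (Ne.symm h), lamDiag, if_neg fun hc => h hc.1]
    simp

lemma Xprime_lamDiag_le_one : Xprime lamDiag ≤ 1 := by
  refine iSup₂_le fun u g => ?_
  rw [ENNReal.ofReal_le_one]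
  refine tsum_le_of_sum_le' zero_le_one fun s => ?_
  have hu := sum_setIntegral_sq_le_one u.2 s
  have hg := sum_setIntegral_sq_le_one g.2 (s.map (Equiv.prodComm _ _).toEmbedding)
  rw [Finset.sum_map] at hg
  refine (Finset.sum_le_sum fun pq _ =>
    abs_lamDiag_term_le (u.2.1 pq.1) (g.2.1 pq.2) pq.1 pq.2).trans ?_
  rw [← Finset.sum_div, Finset.sum_add_distrib]
  simp only [Equiv.coe_toEmbedding, Equiv.prodComm_apply, Prod.fst_swap, Prod.snd_swap] at hg
  rw [div_le_one two_pos]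
  exact (add_le_add hu hg).trans_eq one_add_one_eq_two

lemma Xnorm_le_Xprime (lam : ParaSeq) : Xnorm lam ≤ Xprime lam := by
  refine iSup₂_mono fun u g => ENNReal.ofReal_le_ofReal ?_
  by_cases h : Summable fun pq : (ℤ × ℤ) × (ℤ × ℤ) =>
      ‖lam pq.1 pq.2 * avg (g.1 pq.2) pq.1 * avg (u.1 pq.1) pq.2‖
  · exact norm_tsum_le_tsum_norm h
  · rw [pairSum, tsum_eq_zero_of_not_summable fun h' => h h'.norm, abs_zero]
    exact tsum_nonneg fun _ => abs_nonneg _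

/-- The family whose only nonzero member is the indicator of `[0,1)`, at the index `[0,1)`. -/
def unitFamily : (ℤ × ℤ) → ℝ → ℝ :=
  Pi.single (0, 0) ((Set.Ico (0 : ℝ) 1).indicator 1)

lemma unitFamily_mem_Adm : unitFamily ∈ Adm := by
  have hind : MemLp ((Set.Ico (0 : ℝ) 1).indicator (1 : ℝ → ℝ)) 2 volume :=
    memLp_indicator_const 2 measurableSet_Ico 1 (Or.inr (by simp))
  refine ⟨fun p => ?_, (Set.finite_singleton (0, 0)).subset fun p hp => ?_, ?_⟩
  · by_cases h : p = (0, 0)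
    · subst h
      simpa [unitFamily] using hind
    · simp [unitFamily, Pi.single_eq_of_ne h]
  · by_contra h
    exact hp (Pi.single_eq_of_ne h _)
  · rw [tsum_eq_single (0, 0) fun p hp => by simp [unitFamily, Pi.single_eq_of_ne hp]]
    have hsq : ∀ x : ℝ, (unitFamily (0, 0) x) ^ 2 = (Set.Ico (0 : ℝ) 1).indicator 1 x := by
      intro x
      by_cases hx : x ∈ Set.Ico (0 : ℝ) 1 <;> simp [unitFamily, hx]
    simp [hsq, integral_indicator_one measurableSet_Ico]

lemma avg_unitFamily_zero : avg (unitFamily (0, 0)) (0, 0) = 1 := by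
  simp [avg, dlen, dyadic_zero, unitFamily, setIntegral_indicator measurableSet_Ico]

lemma avg_unitFamily_of_ne {p : ℤ × ℤ} (hp : p ≠ (0, 0)) (q : ℤ × ℤ) :
    avg (unitFamily p) q = 0 := by
  simp [avg, unitFamily, Pi.single_eq_of_ne hp]

lemma pairSum_lamDiag_unitFamily : pairSum lamDiag unitFamily unitFamily = 1 := by
  rw [pairSum, tsum_eq_single ((0, 0), (0, 0))]
  · rw [avg_unitFamily_zero, lamDiag_of_level_eq rfl dyadic_zero.subset dyadic_zero.subset]
    simp [dlen]
  · rintro ⟨p, q⟩ h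
    by_cases hp : p = (0, 0)
    · have hq : q ≠ (0, 0) := fun hq => h (by rw [hp, hq])
      simp [avg_unitFamily_of_ne hq]
    · simp [avg_unitFamily_of_ne hp]

lemma one_le_Xnorm_lamDiag : 1 ≤ Xnorm lamDiag := by
  refine le_iSup₂_of_le ⟨unitFamily, unitFamily_mem_Adm⟩ ⟨unitFamily, unitFamily_mem_Adm⟩ ?_
  simp [pairSum_lamDiag_unitFamily]

lemma dyadic_subset_unit {n k : ℕ} (hk : k < 2 ^ n) : dyadic (n, k) ⊆ Set.Ico (0 : ℝ) 1 := by
  have hpos : (0 : ℝ) < 2 ^ n := by positivity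
  have hk' : (k : ℝ) + 1 ≤ 2 ^ n := by exact_mod_cast hk
  refine Set.Ico_subset_Ico ?_ ?_
  · simp only [Int.cast_natCast]
    positivity
  · simp only [Int.cast_natCast, zpow_neg, zpow_natCast]
    rw [inv_mul_le_iff₀ hpos]
    linarith

/-- The pairs of equal-length dyadic subintervals of `[0,1)`, listed generation by generation. -/
def unitPair (x : Σ n : ℕ, Fin (2 ^ n) × Fin (2 ^ n)) :
    {r : (ℤ × ℤ) × (ℤ × ℤ) // dyadic r.1 ⊆ dyadic (0, 0) ∧ dyadic r.2 ⊆ dyadic (0, 0)} :=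
  ⟨((x.1, (x.2.1 : ℕ)), (x.1, (x.2.2 : ℕ))), by
    rw [dyadic_zero]
    exact ⟨dyadic_subset_unit x.2.1.2, dyadic_subset_unit x.2.2.2⟩⟩

lemma unitPair_injective : Function.Injective unitPair := by
  rintro ⟨n, a, b⟩ ⟨m, c, d⟩ h
  simp only [unitPair, Subtype.mk.injEq, Prod.mk.injEq, Nat.cast_inj] at h
  obtain ⟨⟨rfl, h1⟩, -, h2⟩ := h
  rw [Fin.ext h1, Fin.ext h2]

lemma tsum_lamDiag_sq_unit_eq_top :
    ∑' r : {r : (ℤ × ℤ) × (ℤ × ℤ) // dyadic r.1 ⊆ dyadic (0, 0) ∧ dyadic r.2 ⊆ dyadic (0, 0)},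
      ENNReal.ofReal (lamDiag r.1.1 r.1.2 ^ 2) = ⊤ := by
  refine top_unique (le_trans ?_ (ENNReal.tsum_comp_le_tsum_of_injective unitPair_injective _))
  rw [ENNReal.tsum_sigma']
  have hgen : ∀ n : ℕ, ∑' ab : Fin (2 ^ n) × Fin (2 ^ n),
      ENNReal.ofReal (lamDiag (unitPair ⟨n, ab⟩).1.1 (unitPair ⟨n, ab⟩).1.2 ^ 2) = 1 := by
    intro n
    have hterm : ∀ ab : Fin (2 ^ n) × Fin (2 ^ n),
        lamDiag (unitPair ⟨n, ab⟩).1.1 (unitPair ⟨n, ab⟩).1.2 = ((2 : ℝ) ^ n)⁻¹ := by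
      intro ab
      have h := (unitPair ⟨n, ab⟩).2
      rw [lamDiag_of_level_eq (by simp [unitPair]) (h.1.trans dyadic_zero.subset)
        (h.2.trans dyadic_zero.subset)]
      simp [dlen, unitPair]
    simp only [hterm]
    rw [tsum_fintype, ← ENNReal.ofReal_sum_of_nonneg fun _ _ => by positivity]
    simp only [Finset.sum_const, Finset.card_univ, Fintype.card_prod, Fintype.card_fin,
      nsmul_eq_mul]
    push_cast
    rw [show (2 : ℝ) ^ n * 2 ^ n * ((2 ^ n)⁻¹) ^ 2 = 1 by field_simp, ENNReal.ofReal_one]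
  simp only [hgen]
  exact (ENNReal.tsum_const_eq_top_of_ne_zero one_ne_zero).ge

lemma rectBMO_lamDiag : rectBMO lamDiag = ⊤ := by
  refine top_unique (le_iSup₂_of_le (0, 0) (0, 0) ?_)
  rw [tsum_lamDiag_sq_unit_eq_top]
  simp [dlen]

/-- `lamDiag` is non-negative, `‖λ‖_{X'} = ‖λ‖_X = 1`, and
`‖λ‖_{BMO_rect} = ∞`: `P_λ` is unconditionally bounded although `λ` is not in rectangular
BMO. -/
theorem lamDiag_unconditional_not_rectBMO :
    (∀ p q, 0 ≤ lamDiag p q) ∧ Xprime lamDiag = 1 ∧ Xnorm lamDiag = 1 ∧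
      rectBMO lamDiag = ⊤ := by
  exact ⟨lamDiag_nonneg,
    Xprime_lamDiag_le_one.antisymm (one_le_Xnorm_lamDiag.trans (Xnorm_le_Xprime _)),
    ((Xnorm_le_Xprime _).trans Xprime_lamDiag_le_one).antisymm one_le_Xnorm_lamDiag,
    rectBMO_lamDiag⟩

end
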